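/- Let S : ℝⁿ → ℝ be differentiable with gradient ∇S, and let W : ℝⁿ → ℝⁿ satisfy ⟨W(z), ∇S(z)⟩ = 0 for all z. Let ℋ₂ : ℝⁿ × ℝⁿ → ℝ be convex in its second variable with ℋ₂(z,0) = 0 for all z, set Ψ*(z,ξ) := ℋ₂(z, ξ + ½∇S(z)) − ℋ₂(z, ½∇S(z)) and ℋ(z,ξ) := ⟨W(z), ξ⟩ + ℋ₂(z,ξ), and let 𝓛 and Ψ be the second-variable Legendre transforms of ℋ and Ψ* respectively, assumed finite everywhere. Let F : ℝⁿ → ℝⁿ be a vector field. Then the following are equivalent: (a) ℋ₂ is reversible with respect to S, i.e. ℋ₂(z,ξ) = ℋ₂(z, ∇S(z) − ξ) for all z, ξ, and 𝓛(z, F(z)) = 0 for all z; (b) Ψ* is symmetric, i.e. Ψ*(z,ξ) = Ψ*(z,−ξ), and F is pre-GENERIC: Ψ(z, F(z) − W(z)) + Ψ*(z, −½∇S(z)) + ½⟨F(z), ∇S(z)⟩ = 0 for all z. Moreover, if (a) or (b) holds, then ⟨∇S(z), F(z)⟩ ≤ 0 for all z (S is a Lyapunov function for F). -/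

import Mathlib

open scoped RealInnerProductSpace

/-- Translating the argument of a function by `a` and subtracting a linear form and a constant
changes the Legendre transform by a translation and an affine function. -/
theorem legendre_eq_of_translate {E : Type*} [NormedAddCommGroup E] [InnerProductSpace ℝ E]
    {f g : E → ℝ} {w a v : E} {c l m : ℝ}
    (h : ∀ ξ, g ξ = f (ξ + a) - ⟪w, ξ + a⟫ - c)
    (hl : IsLUB {y : ℝ | ∃ ξ, y = ⟪v, ξ⟫ - f ξ} l)
    (hm : IsLUB {y : ℝ | ∃ ξ, y = ⟪v - w, ξ⟫ - g ξ} m) :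
    l = m - c + ⟪v - w, a⟫ := by
  apply le_antisymm
  · refine hl.2 ?_
    rintro y ⟨ξ, rfl⟩
    have hξ := hm.1 ⟨ξ - a, rfl⟩
    rw [h, sub_add_cancel, inner_sub_right, inner_sub_left v w ξ] at hξ
    linarith
  · have hle : m ≤ l + c - ⟪v - w, a⟫ := by
      refine hm.2 ?_
      rintro y ⟨ξ, rfl⟩
      have hξ := hl.1 ⟨ξ + a, rfl⟩
      rw [h]
      simp only [inner_add_right, inner_sub_left] at hξ ⊢
      linarith
    linarith

/-- A function is invariant under `ξ ↦ b - ξ` iff its translate by `b / 2`, up to a constant,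
is even. -/
theorem reflection_invariant_iff_translate_even {E : Type*} [AddCommGroup E] [Module ℝ E]
    {f g : E → ℝ} {b : E} {c : ℝ} (h : ∀ ξ, g ξ = f (ξ + (2⁻¹ : ℝ) • b) - c) :
    (∀ ξ, f ξ = f (b - ξ)) ↔ ∀ ξ, g ξ = g (-ξ) := by
  constructor
  · intro hf ξ
    rw [h, h, hf]
    congr 2
    module
  · intro hg ξ
    have hξ := hg (ξ - (2⁻¹ : ℝ) • b)
    rw [h, h, sub_add_cancel, sub_left_inj] at hξ
    rw [hξ]
    congr 1
    module

/-- Theorem 3.5: pre-GENERIC is equivalent to the generalized fluctuation symmetry;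
moreover `S` is a Lyapunov function. -/
theorem preGENERIC_iff_generalized_fluctuation_symmetry (n : ℕ)
    (S : EuclideanSpace ℝ (Fin n) → ℝ)
    (gradS : EuclideanSpace ℝ (Fin n) → EuclideanSpace ℝ (Fin n))
    (hS : ∀ z, HasGradientAt S (gradS z) z)
    (W : EuclideanSpace ℝ (Fin n) → EuclideanSpace ℝ (Fin n))
    (hWorth : ∀ z, ⟪W z, gradS z⟫ = 0)
    (H₂ : EuclideanSpace ℝ (Fin n) → EuclideanSpace ℝ (Fin n) → ℝ)
    (hH₂conv : ∀ z, ConvexOn ℝ Set.univ (H₂ z))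
    (hH₂0 : ∀ z, H₂ z 0 = 0)
    (Ψstar : EuclideanSpace ℝ (Fin n) → EuclideanSpace ℝ (Fin n) → ℝ)
    (hΨstar : ∀ z ξ, Ψstar z ξ =
      H₂ z (ξ + (2⁻¹ : ℝ) • gradS z) - H₂ z ((2⁻¹ : ℝ) • gradS z))
    (H : EuclideanSpace ℝ (Fin n) → EuclideanSpace ℝ (Fin n) → ℝ)
    (hH : ∀ z ξ, H z ξ = ⟪W z, ξ⟫ + H₂ z ξ)
    (L Ψ : EuclideanSpace ℝ (Fin n) → EuclideanSpace ℝ (Fin n) → ℝ)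
    (hL : ∀ z v, IsLUB {y : ℝ | ∃ ξ, y = ⟪v, ξ⟫ - H z ξ} (L z v))
    (hΨ : ∀ z v, IsLUB {y : ℝ | ∃ ξ, y = ⟪v, ξ⟫ - Ψstar z ξ} (Ψ z v))
    (F : EuclideanSpace ℝ (Fin n) → EuclideanSpace ℝ (Fin n)) :
    (((∀ z ξ, H₂ z ξ = H₂ z (gradS z - ξ)) ∧ (∀ z, L z (F z) = 0)) ↔
      ((∀ z ξ, Ψstar z ξ = Ψstar z (-ξ)) ∧
        (∀ z, Ψ z (F z - W z) + Ψstar z (-(2⁻¹ : ℝ) • gradS z)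
          + (2⁻¹ : ℝ) * ⟪F z, gradS z⟫ = 0))) ∧
    ((((∀ z ξ, H₂ z ξ = H₂ z (gradS z - ξ)) ∧ (∀ z, L z (F z) = 0)) ∨
      ((∀ z ξ, Ψstar z ξ = Ψstar z (-ξ)) ∧
        (∀ z, Ψ z (F z - W z) + Ψstar z (-(2⁻¹ : ℝ) • gradS z)
          + (2⁻¹ : ℝ) * ⟪F z, gradS z⟫ = 0))) →
      ∀ z, ⟪gradS z, F z⟫ ≤ 0) := by
  have hsymm : (∀ z ξ, H₂ z ξ = H₂ z (gradS z - ξ)) ↔ ∀ z ξ, Ψstar z ξ = Ψstar z (-ξ) :=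
    forall_congr' fun z => reflection_invariant_iff_translate_even (hΨstar z)
  have hlegendre : ∀ z, L z (F z) = Ψ z (F z - W z) + Ψstar z (-(2⁻¹ : ℝ) • gradS z)
      + (2⁻¹ : ℝ) * ⟪F z, gradS z⟫ := by
    intro z
    have hΨstar_half : Ψstar z (-(2⁻¹ : ℝ) • gradS z) = -H₂ z ((2⁻¹ : ℝ) • gradS z) := by
      rw [hΨstar, neg_smul, neg_add_cancel, hH₂0, zero_sub]
    rw [hΨstar_half, legendre_eq_of_translate (c := H₂ z ((2⁻¹ : ℝ) • gradS z)) (w := W z)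
      (a := (2⁻¹ : ℝ) • gradS z) (fun ξ => by rw [hΨstar, hH]; ring) (hL z (F z))
      (hΨ z (F z - W z)), real_inner_smul_right, inner_sub_left, hWorth]
    ring
  have hiff := and_congr hsymm (forall_congr' fun z => by rw [hlegendre z] :
    (∀ z, L z (F z) = 0) ↔ ∀ z, Ψ z (F z - W z) + Ψstar z (-(2⁻¹ : ℝ) • gradS z)
      + (2⁻¹ : ℝ) * ⟪F z, gradS z⟫ = 0)
  refine ⟨hiff, fun hab z => ?_⟩
  obtain ⟨hrev, hzero⟩ := hab.elim id hiff.2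
  have hle := (hL z (F z)).1 ⟨gradS z, rfl⟩
  rw [hzero, hH, hWorth, hrev, sub_self, hH₂0] at hle
  rw [real_inner_comm]
  linarith
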